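/- Let P* be the joint automaton of P₁ and P₂ (with disjoint state sets and connecting transitions T* ⊆ Q₁ × Q₀₂). Then every trace of P* is either a trace of P₁, or has the form ŵ ++ ψ₂ where ŵ is the label sequence of some finite run q₀ … q_k of P₁ from an initial state q₀ ∈ Q₀₁, ψ₂ is the trace of a run of P₂ starting from some state q' ∈ Q₀₂, and (q_k, q') ∈ T*. -/

import Mathlib

/-- An infinite word over `AP` is a function `ℕ → Set AP`. -/
abbrev InfWord (AP : Type*) := ℕ → Set AP

/-- A finite word over `AP` is a list of subsets of `AP`. -/
abbrev FinWord (AP : Type*) := List (Set AP)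

variable {AP : Type*}

/-- `w` is a prefix of the infinite word `ψ` if `w` consists of the first
`w.length` letters of `ψ`. -/
def PrefixOf (w : FinWord AP) (ψ : InfWord AP) : Prop :=
  w = (List.range w.length).map ψ

/-- `w` is a bad prefix for `Psafe` if no infinite word having `w` as a prefix
belongs to `Psafe`. -/
def BadPref (Psafe : Set (InfWord AP)) (w : FinWord AP) : Prop :=
  ∀ ψ : InfWord AP, PrefixOf w ψ → ψ ∉ Psafe

/-- `Psafe` is a safety property if every infinite word not in `Psafe`
has a finite prefix that is a bad prefix for `Psafe`. -/
def IsSafetyProperty (Psafe : Set (InfWord AP)) : Prop :=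
  ∀ ψ : InfWord AP, ψ ∉ Psafe → ∃ w : FinWord AP, PrefixOf w ψ ∧ BadPref Psafe w

/-- An automaton over `AP` with states drawn from type `σ`:
a set of states `Q`, initial states `Q0 ⊆ Q`, a transition relation
`T ⊆ Q × Q`, and a labeling function `L`. -/
structure Automaton (AP : Type*) (σ : Type*) where
  Q : Set σ
  Q0 : Set σ
  T : Set (σ × σ)
  L : σ → Set AP
  Q0_sub : Q0 ⊆ Q
  T_sub : T ⊆ Q ×ˢ Q

variable {σ : Type*}

/-- A run of an automaton: starts in an initial state and follows transitions. -/
def IsRun (P : Automaton AP σ) (ρ : ℕ → σ) : Prop :=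
  ρ 0 ∈ P.Q0 ∧ ∀ i, (ρ i, ρ (i + 1)) ∈ P.T

/-- The trace of a run: its sequence of labels. -/
def trace (P : Automaton AP σ) (ρ : ℕ → σ) : InfWord AP :=
  fun i => P.L (ρ i)

/-- The set of traces of runs of `P`. -/
def Traces (P : Automaton AP σ) : Set (InfWord AP) :=
  {ψ | ∃ ρ : ℕ → σ, IsRun P ρ ∧ ψ = trace P ρ}

/-- `P` satisfies `Psafe` if every trace of `P` belongs to `Psafe`. -/
def Satisfies (P : Automaton AP σ) (Psafe : Set (InfWord AP)) : Prop :=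
  Traces P ⊆ Psafe

/-- A finite run `ρ 0, …, ρ k` of `P` from an initial state. -/
def IsFinRun (P : Automaton AP σ) (ρ : ℕ → σ) (k : ℕ) : Prop :=
  ρ 0 ∈ P.Q0 ∧ ∀ i < k, (ρ i, ρ (i + 1)) ∈ P.T

/-- The label sequence `[L (ρ 0), …, L (ρ k)]` of a finite run. -/
def finLabelSeq (P : Automaton AP σ) (ρ : ℕ → σ) (k : ℕ) : FinWord AP :=
  (List.range (k + 1)).map fun i => P.L (ρ i)

/-- The joint automaton of `P1` and `P2` with connecting transitions
`Tstar ⊆ Q₁ ×ˢ Q₀₂` and labeling `L`. -/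
def jointAutomaton (P1 P2 : Automaton AP σ) (Tstar : Set (σ × σ))
    (L : σ → Set AP) (hT : Tstar ⊆ P1.Q ×ˢ P2.Q0) : Automaton AP σ where
  Q := P1.Q ∪ P2.Q
  Q0 := P1.Q0
  T := P1.T ∪ P2.T ∪ Tstar
  L := L
  Q0_sub := fun _ hq => Or.inl (P1.Q0_sub hq)
  T_sub := by
    rintro ⟨q, q'⟩ ((h | h) | h)
    · exact ⟨Or.inl (P1.T_sub h).1, Or.inl (P1.T_sub h).2⟩
    · exact ⟨Or.inr (P2.T_sub h).1, Or.inr (P2.T_sub h).2⟩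
    · exact ⟨Or.inl (hT h).1, Or.inr (P2.Q0_sub (hT h).2)⟩

/-- The infinite word obtained by prepending the finite word `w`
to the infinite word `ψ`. -/
def prepend (w : FinWord AP) (ψ : InfWord AP) : InfWord AP :=
  fun i => if h : i < w.length then w[i] else ψ (i - w.length)

/-- The first component of the joint automaton can only be left by a connecting transition. -/
theorem joint_step_of_mem_left {P1 P2 : Automaton AP σ} (hdisj : Disjoint P1.Q P2.Q)
    {Tstar : Set (σ × σ)} {L : σ → Set AP} {hT : Tstar ⊆ P1.Q ×ˢ P2.Q0} {q q' : σ}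
    (h : (q, q') ∈ (jointAutomaton P1 P2 Tstar L hT).T) (hq : q ∈ P1.Q) :
    (q, q') ∈ P1.T ∨ (q, q') ∈ Tstar := by
  rcases h with (h | h) | h
  · exact Or.inl h
  · exact (hdisj.notMem_of_mem_left hq (P2.T_sub h).1).elim
  · exact Or.inr h

/-- The second component of the joint automaton cannot be left. -/
theorem joint_step_of_mem_right {P1 P2 : Automaton AP σ} (hdisj : Disjoint P1.Q P2.Q)
    {Tstar : Set (σ × σ)} {L : σ → Set AP} {hT : Tstar ⊆ P1.Q ×ˢ P2.Q0} {q q' : σ}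
    (h : (q, q') ∈ (jointAutomaton P1 P2 Tstar L hT).T) (hq : q ∈ P2.Q) :
    (q, q') ∈ P2.T := by
  rcases h with (h | h) | h
  · exact (hdisj.notMem_of_mem_left (P1.T_sub h).1 hq).elim
  · exact h
  · exact (hdisj.notMem_of_mem_left (hT h).1 hq).elim

/-- Every trace of the joint automaton of `P1` and `P2` is either a trace of
`P1`, or of the form `ŵ ++ ψ₂` where `ŵ` is the label sequence of a finite run
`q₀ … q_k` of `P1` from an initial state, `ψ₂` is the trace of a run of `P2`
starting from some `q' ∈ Q₀₂`, and `(q_k, q') ∈ T*`. -/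
theorem joint_trace_decomposition (P1 P2 : Automaton AP σ)
    (hdisj : Disjoint P1.Q P2.Q)
    (Tstar : Set (σ × σ)) (hT : Tstar ⊆ P1.Q ×ˢ P2.Q0)
    (L : σ → Set AP)
    (hL1 : ∀ q ∈ P1.Q, L q = P1.L q) (hL2 : ∀ q ∈ P2.Q, L q = P2.L q)
    (ψ : InfWord AP) (hψ : ψ ∈ Traces (jointAutomaton P1 P2 Tstar L hT)) :
    ψ ∈ Traces P1 ∨
      ∃ (ρ1 : ℕ → σ) (k : ℕ) (q' : σ) (ρ2 : ℕ → σ),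
        IsFinRun P1 ρ1 k ∧ q' ∈ P2.Q0 ∧ (ρ1 k, q') ∈ Tstar ∧
        ρ2 0 = q' ∧ (∀ i, (ρ2 i, ρ2 (i + 1)) ∈ P2.T) ∧
        ψ = prepend (finLabelSeq P1 ρ1 k) (trace P2 ρ2) := by
  obtain ⟨ρ, ⟨h0, hstep⟩, rfl⟩ := hψ
  have hmem0 : ρ 0 ∈ P1.Q := P1.Q0_sub h0
  by_cases hall : ∀ i, (ρ i, ρ (i + 1)) ∈ P1.T
  · exact Or.inl ⟨ρ, ⟨h0, hall⟩, funext fun i => hL1 _ (P1.T_sub (hall i)).1⟩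
  right
  push Not at hall
  classical
  obtain ⟨k, hk, hlt⟩ : ∃ k, (ρ k, ρ (k + 1)) ∉ P1.T ∧ ∀ i < k, (ρ i, ρ (i + 1)) ∈ P1.T :=
    ⟨Nat.find hall, Nat.find_spec hall, fun i hi => not_not.mp (Nat.find_min hall hi)⟩
  have hleft : ∀ i ≤ k, ρ i ∈ P1.Q := by
    rintro (_ | i) hi
    · exact hmem0
    · exact (P1.T_sub (hlt i hi)).2
  have hconn : (ρ k, ρ (k + 1)) ∈ Tstar :=
    (joint_step_of_mem_left hdisj (hstep k) (hleft k le_rfl)).resolve_left hk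
  have hright : ∀ i, ρ (k + 1 + i) ∈ P2.Q := by
    intro i
    induction i with
    | zero => exact P2.Q0_sub (hT hconn).2
    | succ i ih => exact (P2.T_sub (joint_step_of_mem_right hdisj (hstep _) ih)).2
  refine ⟨ρ, k, ρ (k + 1), fun i => ρ (k + 1 + i), ⟨h0, hlt⟩, (hT hconn).2, hconn, rfl,
    fun i => joint_step_of_mem_right hdisj (hstep _) (hright i), funext fun i => ?_⟩
  by_cases hi : i < k + 1
  · simpa [prepend, finLabelSeq, trace, jointAutomaton, hi] using
      hL1 _ (hleft i (Nat.lt_succ_iff.mp hi))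
  · obtain ⟨j, rfl⟩ := Nat.exists_eq_add_of_le (not_lt.mp hi)
    have hj : ¬ k + 1 + j ≤ k := by omega
    simpa [prepend, finLabelSeq, trace, jointAutomaton, hj] using hL2 _ (hright j)
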